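/- arXiv:2602.18295 — 4 statements merged into one kernel-verified Lean document; each statement's English description precedes it below -/
import Mathlib

section
/- Adequacy theorem: For every ρ-bialgebra (X, a, c), the Σ-algebra (X, a) is computationally adequate; concretely, beh = inj ∘ ⟦−⟧, where ⟦−⟧ : μΣ → X is the unique Σ-algebra morphism from the initial algebra and inj : X → νB(μΣ,−) is the unique B(μΣ,−)-coalgebra morphism from the coalgebra (X, B(⟦−⟧, id) ∘ c) to the final coalgebra. -/
open CategoryTheory CategoryTheory.Limits Opposite

universe v u

/-- A free `S`-algebra on an object `X` (providing the object `S*X` of the free monad). -/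
structure FreeAlg {C : Type u} [Category.{v} C] (S : C ⥤ C) (X : C) where
  carrier : C
  emb : X ⟶ carrier
  act : S.obj carrier ⟶ carrier
  desc : ∀ {A : C}, (S.obj A ⟶ A) → (X ⟶ A) → (carrier ⟶ A)
  emb_desc : ∀ {A : C} (a : S.obj A ⟶ A) (h : X ⟶ A), emb ≫ desc a h = h
  act_desc : ∀ {A : C} (a : S.obj A ⟶ A) (h : X ⟶ A),
    act ≫ desc a h = S.map (desc a h) ≫ a
  desc_unique : ∀ {A : C} (a : S.obj A ⟶ A) (h : X ⟶ A) (k : carrier ⟶ A),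
    emb ≫ k = h → act ≫ k = S.map k ≫ a → k = desc a h

/-- An initial `S`-algebra `μS`. -/
structure InitAlg {C : Type u} [Category.{v} C] (S : C ⥤ C) where
  carrier : C
  str : S.obj carrier ⟶ carrier
  fold : ∀ {A : C}, (S.obj A ⟶ A) → (carrier ⟶ A)
  fold_comm : ∀ {A : C} (a : S.obj A ⟶ A), str ≫ fold a = S.map (fold a) ≫ a
  fold_unique : ∀ {A : C} (a : S.obj A ⟶ A) (k : carrier ⟶ A),
    str ≫ k = S.map k ≫ a → k = fold a

variable {C : Type u} [Category.{v} C] [HasBinaryProducts C] [HasBinaryCoproducts C]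

/-- The action of the free monad `S*` on a morphism. -/
def freeMap {S : C ⥤ C} (F : ∀ X : C, FreeAlg S X) {X Y : C} (f : X ⟶ Y) :
    (F X).carrier ⟶ (F Y).carrier :=
  (F X).desc (F Y).act (f ≫ (F Y).emb)

/-- A higher-order GSOS law of `S` over `B`: a family
`ρ_{X,Y} : S(X × B(X,Y)) ⟶ B(X, S*(X+Y))` dinatural in `X` and natural in `Y`. -/
structure HOGSOSLaw (S : C ⥤ C) (B : Cᵒᵖ × C ⥤ C) (F : ∀ X : C, FreeAlg S X) where
  app : ∀ X Y : C, S.obj (X ⨯ B.obj (op X, Y)) ⟶ B.obj (op X, (F (X ⨿ Y)).carrier)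
  dinatural : ∀ {X X' Y : C} (f : X ⟶ X'),
    S.map (prod.map f (𝟙 (B.obj (op X', Y)))) ≫ app X' Y ≫
        B.map ((f.op, 𝟙 ((F (X' ⨿ Y)).carrier)) :
          (op X', (F (X' ⨿ Y)).carrier) ⟶ (op X, (F (X' ⨿ Y)).carrier))
      = S.map (prod.map (𝟙 X) (B.map ((f.op, 𝟙 Y) : (op X', Y) ⟶ (op X, Y)))) ≫ app X Y ≫
        B.map ((𝟙 (op X), freeMap F (coprod.map f (𝟙 Y))) :
          (op X, (F (X ⨿ Y)).carrier) ⟶ (op X, (F (X' ⨿ Y)).carrier))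
  natural : ∀ {X Y Y' : C} (g : Y ⟶ Y'),
    S.map (prod.map (𝟙 X) (B.map ((𝟙 (op X), g) : (op X, Y) ⟶ (op X, Y')))) ≫ app X Y'
      = app X Y ≫ B.map ((𝟙 (op X), freeMap F (coprod.map (𝟙 X) g)) :
          (op X, (F (X ⨿ Y)).carrier) ⟶ (op X, (F (X ⨿ Y')).carrier))

/-- `(X, a, c)` is a `ρ`-bialgebra for the law with components `ρ`. -/
def IsBialgebra (S : C ⥤ C) (B : Cᵒᵖ × C ⥤ C) (F : ∀ X : C, FreeAlg S X)
    (ρ : ∀ X Y : C, S.obj (X ⨯ B.obj (op X, Y)) ⟶ B.obj (op X, (F (X ⨿ Y)).carrier))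
    (X : C) (a : S.obj X ⟶ X) (c : X ⟶ B.obj (op X, X)) : Prop :=
  a ≫ c = S.map (prod.lift (𝟙 X) c) ≫ ρ X X ≫
    B.map ((𝟙 (op X), (F (X ⨿ X)).desc a (coprod.desc (𝟙 X) (𝟙 X))) :
      (op X, (F (X ⨿ X)).carrier) ⟶ (op X, X))


/-- Two-sided composition of the action of a bifunctor on pairs of morphisms. -/
theorem bifunctor_map_comp {D : Type u} [Category.{v} D] (B : Dᵒᵖ × D ⥤ D)
    {P P' P'' : Dᵒᵖ} {Q Q' Q'' : D} (f : P ⟶ P') (g : P' ⟶ P'') (h : Q ⟶ Q') (k : Q' ⟶ Q'') :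
    B.map ((f, h) : (P, Q) ⟶ (P', Q')) ≫ B.map ((g, k) : (P', Q') ⟶ (P'', Q'')) =
      B.map ((f ≫ g, h ≫ k) : (P, Q) ⟶ (P'', Q'')) :=
  (B.map_comp _ _).symm

/-- The two partial actions of a bifunctor commute. -/
theorem bifunctor_map_swap {D : Type u} [Category.{v} D] (B : Dᵒᵖ × D ⥤ D)
    {P P' : Dᵒᵖ} {Q Q' : D} (f : P ⟶ P') (h : Q ⟶ Q') :
    B.map ((𝟙 P, h) : (P, Q) ⟶ (P, Q')) ≫ B.map ((f, 𝟙 Q') : (P, Q') ⟶ (P', Q')) =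
      B.map ((f, 𝟙 Q) : (P, Q) ⟶ (P', Q)) ≫ B.map ((𝟙 P', h) : (P', Q) ⟶ (P', Q')) := by
  rw [bifunctor_map_comp, bifunctor_map_comp]
  simp only [Category.id_comp, Category.comp_id]

theorem FreeAlg.desc_comp {D : Type u} [Category.{v} D] {S : D ⥤ D} {X A A' : D}
    (T : FreeAlg S X) (a : S.obj A ⟶ A) (a' : S.obj A' ⟶ A') (h : X ⟶ A) (f : A ⟶ A')
    (hf : a ≫ f = S.map f ≫ a') : T.desc a h ≫ f = T.desc a' (h ≫ f) := by
  apply T.desc_unique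
  · rw [← Category.assoc, T.emb_desc]
  · rw [← Category.assoc, T.act_desc, Category.assoc, hf, S.map_comp, Category.assoc]

theorem freeMap_desc {D : Type u} [Category.{v} D] {S : D ⥤ D} (F : ∀ X : D, FreeAlg S X)
    {X Y A : D} (f : X ⟶ Y) (a : S.obj A ⟶ A) (h : Y ⟶ A) :
    freeMap F f ≫ (F Y).desc a h = (F X).desc a (f ≫ h) := by
  rw [freeMap, FreeAlg.desc_comp (F X) _ a _ _ ((F Y).act_desc a h), Category.assoc,
    (F Y).emb_desc]

/-- Uniqueness part of primitive recursion over an initial algebra. -/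
theorem InitAlg.primrec_unique {D : Type u} [Category.{v} D] [HasBinaryProducts D] {S : D ⥤ D}
    (μ : InitAlg S) {A : D} (φ : S.obj (μ.carrier ⨯ A) ⟶ A) {k l : μ.carrier ⟶ A}
    (hk : μ.str ≫ k = S.map (prod.lift (𝟙 μ.carrier) k) ≫ φ)
    (hl : μ.str ≫ l = S.map (prod.lift (𝟙 μ.carrier) l) ≫ φ) : k = l := by
  have key : ∀ m : μ.carrier ⟶ A, μ.str ≫ m = S.map (prod.lift (𝟙 μ.carrier) m) ≫ φ →
      prod.lift (𝟙 μ.carrier) m = μ.fold (prod.lift (S.map prod.fst ≫ μ.str) φ) := by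
    intro m hm
    apply μ.fold_unique
    apply Limits.prod.hom_ext
    · rw [Category.assoc, Category.assoc, prod.lift_fst, prod.lift_fst, ← S.map_comp_assoc,
        prod.lift_fst, S.map_id, Category.id_comp, Category.comp_id]
    · rw [Category.assoc, Category.assoc, prod.lift_snd, prod.lift_snd, hm]
  rw [← prod.lift_snd (𝟙 μ.carrier) k, key k hk, ← key l hl, prod.lift_snd]

/-- The catamorphism into a bialgebra relates the operational model to the bialgebra. -/
theorem operational_model_fold
    (S : C ⥤ C) (B : Cᵒᵖ × C ⥤ C) (F : ∀ X : C, FreeAlg S X)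
    (μ : InitAlg S) (ρ : HOGSOSLaw S B F)
    (γ : μ.carrier ⟶ B.obj (op μ.carrier, μ.carrier))
    (hγ : IsBialgebra S B F ρ.app μ.carrier μ.str γ)
    (X : C) (a : S.obj X ⟶ X) (c : X ⟶ B.obj (op X, X))
    (hbi : IsBialgebra S B F ρ.app X a c) :
    γ ≫ B.map ((𝟙 (op μ.carrier), μ.fold a) :
        (op μ.carrier, μ.carrier) ⟶ (op μ.carrier, X)) =
      μ.fold a ≫ c ≫ B.map (((μ.fold a).op, 𝟙 X) : (op X, X) ⟶ (op μ.carrier, X)) := by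
  unfold IsBialgebra at hγ hbi
  have hf := μ.fold_comm a
  generalize μ.fold a = f at hf ⊢
  apply μ.primrec_unique (ρ.app μ.carrier X ≫
    B.map ((𝟙 (op μ.carrier), (F (μ.carrier ⨿ X)).desc a (coprod.desc f (𝟙 X))) :
      (op μ.carrier, (F (μ.carrier ⨿ X)).carrier) ⟶ (op μ.carrier, X)))
  · have hd : (F (μ.carrier ⨿ μ.carrier)).desc μ.str
          (coprod.desc (𝟙 μ.carrier) (𝟙 μ.carrier)) ≫ f =
        freeMap F (coprod.map (𝟙 μ.carrier) f) ≫
          (F (μ.carrier ⨿ X)).desc a (coprod.desc f (𝟙 X)) := by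
      rw [FreeAlg.desc_comp _ _ a _ f hf, freeMap_desc]
      simp
    have hp : prod.lift (𝟙 μ.carrier) (γ ≫ B.map ((𝟙 (op μ.carrier), f) :
          (op μ.carrier, μ.carrier) ⟶ (op μ.carrier, X))) =
        prod.lift (𝟙 μ.carrier) γ ≫ prod.map (𝟙 μ.carrier) (B.map ((𝟙 (op μ.carrier), f) :
          (op μ.carrier, μ.carrier) ⟶ (op μ.carrier, X))) := by
      simp
    rw [reassoc_of% hγ, hp, S.map_comp, Category.assoc, ← Category.assoc (S.map (prod.map _ _)),
      ρ.natural, Category.assoc, bifunctor_map_comp, bifunctor_map_comp, hd]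
  · have hd : freeMap F (coprod.map f (𝟙 X)) ≫
          (F (X ⨿ X)).desc a (coprod.desc (𝟙 X) (𝟙 X)) =
        (F (μ.carrier ⨿ X)).desc a (coprod.desc f (𝟙 X)) := by
      rw [freeMap_desc]
      simp
    have hp : f ≫ prod.lift (𝟙 X) c =
        prod.lift (𝟙 μ.carrier) (f ≫ c) ≫ prod.map f (𝟙 (B.obj (op X, X))) := by
      simp
    have hq : prod.lift (𝟙 μ.carrier) (f ≫ c ≫ B.map ((f.op, 𝟙 X) :
          (op X, X) ⟶ (op μ.carrier, X))) =
        prod.lift (𝟙 μ.carrier) (f ≫ c) ≫ prod.map (𝟙 μ.carrier) (B.map ((f.op, 𝟙 X) :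
          (op X, X) ⟶ (op μ.carrier, X))) := by
      simp
    rw [reassoc_of% hf, reassoc_of% hbi, ← S.map_comp_assoc, hp, bifunctor_map_swap,
      S.map_comp, Category.assoc, reassoc_of% (ρ.dinatural (Y := X) f), bifunctor_map_comp,
      Category.id_comp, hd, hq, S.map_comp, Category.assoc]

/-- **Adequacy.** For every `ρ`-bialgebra `(X, a, c)`, the `Σ`-algebra
`(X, a)` is computationally adequate: `beh = inj ∘ ⟦−⟧`, where `⟦−⟧ : μΣ ⟶ X` is the
unique `Σ`-algebra morphism from the initial algebra and `inj : X ⟶ νB(μΣ,−)` is the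
unique `B(μΣ,−)`-coalgebra morphism from `(X, B(⟦−⟧,id) ∘ c)` to the final coalgebra. -/
theorem bialgebra_adequacy
    (S : C ⥤ C) (B : Cᵒᵖ × C ⥤ C) (F : ∀ X : C, FreeAlg S X)
    (μ : InitAlg S) (ρ : HOGSOSLaw S B F)
    -- the operational model γ of ρ
    (γ : μ.carrier ⟶ B.obj (op μ.carrier, μ.carrier))
    (hγ : μ.str ≫ γ = S.map (prod.lift (𝟙 μ.carrier) γ) ≫ ρ.app μ.carrier μ.carrier ≫
      B.map ((𝟙 (op μ.carrier),
          (F (μ.carrier ⨿ μ.carrier)).desc μ.str (coprod.desc (𝟙 μ.carrier) (𝟙 μ.carrier))) :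
        (op μ.carrier, (F (μ.carrier ⨿ μ.carrier)).carrier) ⟶ (op μ.carrier, μ.carrier)))
    -- a final coalgebra (ν, ζ) for the endofunctor B(μΣ, −)
    (ν : C) (ζ : ν ⟶ B.obj (op μ.carrier, ν))
    (hν : ∀ (A : C) (c : A ⟶ B.obj (op μ.carrier, A)),
      ∃! h : A ⟶ ν, h ≫ ζ = c ≫ B.map ((𝟙 (op μ.carrier), h) : (op μ.carrier, A) ⟶ (op μ.carrier, ν)))
    -- beh : μΣ ⟶ ν, the unique B(μΣ,−)-coalgebra morphism from (μΣ, γ)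
    (beh : μ.carrier ⟶ ν)
    (hbeh : beh ≫ ζ = γ ≫ B.map ((𝟙 (op μ.carrier), beh) :
      (op μ.carrier, μ.carrier) ⟶ (op μ.carrier, ν)))
    -- an arbitrary ρ-bialgebra (X, a, c)
    (X : C) (a : S.obj X ⟶ X) (c : X ⟶ B.obj (op X, X))
    (hbi : IsBialgebra S B F ρ.app X a c) :
    ∃ inj : X ⟶ ν,
      (inj ≫ ζ = c ≫ B.map (((μ.fold a).op, 𝟙 X) : (op X, X) ⟶ (op μ.carrier, X)) ≫
        B.map ((𝟙 (op μ.carrier), inj) : (op μ.carrier, X) ⟶ (op μ.carrier, ν))) ∧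
      beh = μ.fold a ≫ inj := by
  obtain ⟨inj, hinj, -⟩ := hν X
    (c ≫ B.map (((μ.fold a).op, 𝟙 X) : (op X, X) ⟶ (op μ.carrier, X)))
  rw [Category.assoc] at hinj
  refine ⟨inj, hinj, (hν μ.carrier γ).unique hbeh ?_⟩
  have key := operational_model_fold S B F μ ρ γ hγ X a c hbi
  rw [Category.assoc, hinj, ← reassoc_of% key, bifunctor_map_comp, Category.id_comp]
end

section
/- The xTCL behaviour bifunctor B is locally contractive with factor 1/2 in its first argument and locally non-expansive in its second argument: for all parallel pairs f, g of morphisms in Set^Ty, d(B(f,id), B(g,id)) ≤ (1/2)·d(f,g) and d(B(id,f), B(id,g)) ≤ d(f,g). -/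
universe u

/-- Simple types: `Ty ::= unit | Ty → Ty`. -/
inductive Ty : Type
  | unit : Ty
  | arrow : Ty → Ty → Ty

/-- `Ty`-sorted sets, the objects of `Set^Ty`. -/
abbrev TySet := Ty → Type u

/-- `Ty`-sorted functions, the morphisms of `Set^Ty`. -/
abbrev TyHom (A B : TySet.{u}) := ∀ τ : Ty, A τ → B τ

/-- Identity morphism of `Set^Ty`. -/
def tyId (A : TySet.{u}) : TyHom A A := fun _ x => x

/-- Composition in `Set^Ty` (diagrammatic order). -/
def tyComp {A B C : TySet.{u}} (f : TyHom A B) (g : TyHom B C) : TyHom A C :=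
  fun τ x => g τ (f τ x)

/-- The xTCL behaviour bifunctor on objects:
`B_unit(X,Y) = Y_unit + 1`, `B_{τ₁→τ₂}(X,Y) = Y_{τ₁→τ₂} + Y_{τ₂}^{X_{τ₁}}`. -/
def BObj (X Y : TySet.{u}) : TySet.{u} := fun τ =>
  match τ with
  | .unit => Y .unit ⊕ PUnit
  | .arrow τ₁ τ₂ => Y (.arrow τ₁ τ₂) ⊕ (X τ₁ → Y τ₂)

/-- The action of the bifunctor `B` on morphisms: contravariant in the first
argument, covariant in the second one. -/
def BMap {X X' Y Y' : TySet.{u}} (f : TyHom X' X) (g : TyHom Y Y') :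
    TyHom (BObj X Y) (BObj X' Y')
  | .unit, .inl y => .inl (g .unit y)
  | .unit, .inr u => .inr u
  | .arrow τ₁ τ₂, .inl y => .inl (g (.arrow τ₁ τ₂) y)
  | .arrow τ₁ τ₂, .inr φ => .inr (fun x => g τ₂ (φ (f τ₁ x)))

/-- `h` is a morphism of higher-order `B`-coalgebras `(X,c) → (Y,d)`:
`B(id_X, h) ∘ c = B(h, id_Y) ∘ d ∘ h`. -/
def IsHOCoalgHom {X Y : TySet.{u}} (c : TyHom X (BObj X X)) (d : TyHom Y (BObj Y Y))
    (h : TyHom X Y) : Prop :=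
  ∀ (τ : Ty) (x : X τ), BMap (tyId X) h τ (c τ x) = BMap h (tyId Y) τ (d τ (h τ x))

/-- The complexity of a type: `|unit| = 1`, `|τ₁→τ₂| = |τ₁| + |τ₂|`. -/
def complexity : Ty → ℕ
  | .unit => 1
  | .arrow τ₁ τ₂ => complexity τ₁ + complexity τ₂

/-- The metric on hom-sets of `Set^Ty`:
`d(f,g) = sup{ 2^{-(|τ|-1)} : τ ∈ Ty, f_τ ≠ g_τ }` (with `sup ∅ = 0`). -/
noncomputable def tyDist {A B : TySet.{u}} (f g : TyHom A B) : ℝ :=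
  sSup {x : ℝ | ∃ τ : Ty, f τ ≠ g τ ∧ x = (2 : ℝ) ^ (-((complexity τ : ℤ) - 1))}

theorem one_le_complexity (τ : Ty) : 1 ≤ complexity τ := by
  induction τ with
  | unit => exact le_rfl
  | arrow τ₁ τ₂ h₁ h₂ => simp only [complexity]; omega

theorem tyDist_le {A B : TySet.{u}} {f g : TyHom A B} {r : ℝ} (hr : 0 ≤ r)
    (h : ∀ τ, f τ ≠ g τ → (2 : ℝ) ^ (-((complexity τ : ℤ) - 1)) ≤ r) : tyDist f g ≤ r := by
  refine Real.sSup_le ?_ hr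
  rintro _ ⟨τ, hτ, rfl⟩
  exact h τ hτ

theorem tyDist_nonneg {A B : TySet.{u}} (f g : TyHom A B) : 0 ≤ tyDist f g := by
  refine Real.sSup_nonneg ?_
  rintro _ ⟨τ, -, rfl⟩
  positivity

theorem le_tyDist {A B : TySet.{u}} {f g : TyHom A B} {τ : Ty} (h : f τ ≠ g τ) :
    (2 : ℝ) ^ (-((complexity τ : ℤ) - 1)) ≤ tyDist f g := by
  refine le_csSup ⟨1, ?_⟩ ⟨τ, h, rfl⟩
  rintro _ ⟨σ, -, rfl⟩
  have := one_le_complexity σ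
  exact zpow_le_one_of_nonpos₀ one_le_two (by omega)

theorem BMap_congr_unit {X X' Y Y' : TySet.{u}} {f f' : TyHom X' X} {g g' : TyHom Y Y'}
    (h : g .unit = g' .unit) : BMap f g .unit = BMap f' g' .unit := by
  funext x
  rcases x with y | y <;> simp only [BMap, h] <;> rfl

theorem BMap_congr_arrow {X X' Y Y' : TySet.{u}} {f f' : TyHom X' X} {g g' : TyHom Y Y'}
    {τ₁ τ₂ : Ty} (h₁ : f τ₁ = f' τ₁) (h₂ : g τ₂ = g' τ₂)
    (h : g (.arrow τ₁ τ₂) = g' (.arrow τ₁ τ₂)) :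
    BMap f g (.arrow τ₁ τ₂) = BMap f' g' (.arrow τ₁ τ₂) := by
  funext x
  rcases x with y | y <;> simp only [BMap, h, h₁, h₂] <;> rfl

/-- The xTCL behaviour bifunctor `B` is locally contractive with
factor `1/2` in its first argument and locally non-expansive in its second argument. -/
theorem BObj_contractive_nonexpansive :
    (∀ (X X' Y : TySet.{u}) (f g : TyHom X X'),
      tyDist (BMap (Y := Y) f (tyId Y)) (BMap g (tyId Y)) ≤ (1 / 2) * tyDist f g) ∧
    (∀ (X Y Y' : TySet.{u}) (f g : TyHom Y Y'),
      tyDist (BMap (tyId X) f) (BMap (tyId X) g) ≤ tyDist f g) := by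
  refine ⟨fun X X' Y f g => ?_, fun X Y Y' f g => ?_⟩
  · refine tyDist_le (mul_nonneg (by norm_num) (tyDist_nonneg f g)) fun τ hτ => ?_
    cases τ with
    | unit => exact absurd (BMap_congr_unit rfl) hτ
    | arrow τ₁ τ₂ =>
      have hne : f τ₁ ≠ g τ₁ := fun h => hτ (BMap_congr_arrow h rfl rfl)
      have hpos := one_le_complexity τ₂
      calc (2 : ℝ) ^ (-((complexity (.arrow τ₁ τ₂) : ℤ) - 1))
          ≤ 2 ^ (-1 + -((complexity τ₁ : ℤ) - 1)) :=
            zpow_le_zpow_right₀ one_le_two (by simp only [complexity]; omega)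
        _ = 1 / 2 * 2 ^ (-((complexity τ₁ : ℤ) - 1)) := by
            rw [zpow_add₀ two_ne_zero, zpow_neg_one, one_div]
        _ ≤ 1 / 2 * tyDist f g := by gcongr; exact le_tyDist hne
  · refine tyDist_le (tyDist_nonneg f g) fun τ hτ => ?_
    cases τ with
    | unit => exact le_tyDist fun h => hτ (BMap_congr_unit h)
    | arrow τ₁ τ₂ =>
      by_cases h : f (.arrow τ₁ τ₂) = g (.arrow τ₁ τ₂)
      · have hne : f τ₂ ≠ g τ₂ := fun h₂ => hτ (BMap_congr_arrow rfl h₂ h)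
        refine le_trans (zpow_le_zpow_right₀ one_le_two ?_) (le_tyDist hne)
        simp only [complexity]
        omega
      · exact le_tyDist h
end

section
/- The bifunctor B^u(X,Y) = ▷Y + (▷Y)^{▷X} on the topos of trees is locally contractive with factor 1/2 in each argument: for all parallel pairs f, g of morphisms in Set^{ω^op}, d(B^u(f,id), B^u(g,id)) ≤ (1/2)·d(f,g) and d(B^u(id,f), B^u(id,g)) ≤ (1/2)·d(f,g). -/
universe u

/-- An object of the topos of trees `Set^{ω^op}`: a family of sets `(X_n)` with
restriction maps `X_{n+1} → X_n` (generating all restrictions `X_n → X_m`, `n ≥ m`). -/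
structure OmTree : Type (u + 1) where
  obj : ℕ → Type u
  res : ∀ n : ℕ, obj (n + 1) → obj n

/-- A morphism of `Set^{ω^op}`: a natural transformation. -/
@[ext]
structure OmTreeHom (X Y : OmTree.{u}) where
  app : ∀ n : ℕ, X.obj n → Y.obj n
  natural : ∀ (n : ℕ) (x : X.obj (n + 1)), Y.res n (app (n + 1) x) = app n (X.res n x)

/-- The identity morphism. -/
def OmTreeHom.id (X : OmTree.{u}) : OmTreeHom X X :=
  ⟨fun _ x => x, fun _ _ => rfl⟩

/-- Composition (diagrammatic order). -/
def OmTreeHom.comp {X Y Z : OmTree.{u}} (f : OmTreeHom X Y) (g : OmTreeHom Y Z) : OmTreeHom X Z where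
  app n x := g.app n (f.app n x)
  natural n x := by rw [g.natural, f.natural]

/-- The object part of the later modality: `(▷X)_0 = 1`, `(▷X)_{n+1} = X_n`. -/
def laterObj (X : OmTree.{u}) : ℕ → Type u
  | 0 => PUnit
  | n + 1 => X.obj n

/-- The restrictions of the later modality. -/
def laterRes (X : OmTree.{u}) : ∀ n : ℕ, laterObj X (n + 1) → laterObj X n
  | 0 => fun _ => PUnit.unit
  | n + 1 => X.res n

/-- The later modality `▷ : Set^{ω^op} → Set^{ω^op}` on objects. -/
def later (X : OmTree.{u}) : OmTree.{u} := ⟨laterObj X, laterRes X⟩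

/-- The action of `▷` on morphisms. -/
def laterMap {X Y : OmTree.{u}} (f : OmTreeHom X Y) : OmTreeHom (later X) (later Y) where
  app n := match n with
    | 0 => fun x => x
    | n + 1 => f.app n
  natural n x := by cases n with
    | zero => rfl
    | succ m => exact f.natural m x

/-- An element of the exponential `(Y^X)_n` in `Set^{ω^op}`: a tuple of maps
`(f_i : X_i → Y_i)_{i ≤ n}` commuting with the restriction maps. -/
structure ExpEl (X Y : OmTree.{u}) (n : ℕ) : Type u where
  comp : ∀ i : ℕ, i ≤ n → X.obj i → Y.obj i
  natural : ∀ (i : ℕ) (h : i + 1 ≤ n) (x : X.obj (i + 1)),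
    Y.res i (comp (i + 1) h x) = comp i (Nat.le_of_succ_le h) (X.res i x)

/-- Restriction of exponentials. -/
def expRes (X Y : OmTree.{u}) (n : ℕ) (e : ExpEl X Y (n + 1)) : ExpEl X Y n where
  comp i h := e.comp i (Nat.le_succ_of_le h)
  natural i h x := e.natural i (Nat.le_succ_of_le h) x

/-- The xCL behaviour bifunctor on objects: `B^u(X,Y) = ▷Y + (▷Y)^{▷X}`. -/
def BuObj (X Y : OmTree.{u}) : OmTree.{u} where
  obj n := laterObj Y n ⊕ ExpEl (later X) (later Y) n
  res n := Sum.map (laterRes Y n) (expRes (later X) (later Y) n)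

/-- Precomposition of an exponential element with a morphism. -/
def expPre {X X' Y : OmTree.{u}} (f : OmTreeHom X X') (n : ℕ) (e : ExpEl X' Y n) :
    ExpEl X Y n where
  comp i h x := e.comp i h (f.app i x)
  natural i h x := by rw [e.natural, f.natural]

/-- Postcomposition of an exponential element with a morphism. -/
def expPost {X Y Y' : OmTree.{u}} (g : OmTreeHom Y Y') (n : ℕ) (e : ExpEl X Y n) :
    ExpEl X Y' n where
  comp i h x := g.app i (e.comp i h x)
  natural i h x := by rw [g.natural, e.natural]

/-- The contravariant action of `B^u` in its first argument: `B^u(f, id)`. -/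
def BuMapL {X X' : OmTree.{u}} (Y : OmTree.{u}) (f : OmTreeHom X X') :
    OmTreeHom (BuObj X' Y) (BuObj X Y) where
  app n := Sum.map (fun y => y) (expPre (laterMap f) n)
  natural n x := by cases x <;> rfl

/-- The covariant action of `B^u` in its second argument: `B^u(id, g)`. -/
def BuMapR (X : OmTree.{u}) {Y Y' : OmTree.{u}} (g : OmTreeHom Y Y') :
    OmTreeHom (BuObj X Y) (BuObj X Y') where
  app n := Sum.map ((laterMap g).app n) (expPost (laterMap g) n)
  natural n x := by
    cases x with
    | inl y => exact congrArg Sum.inl ((laterMap g).natural n y)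
    | inr e => rfl

/-- The metric on hom-sets of the topos of trees:
`d(μ,ν) = sup{ 2^{-n} : n ∈ ω, μ_n ≠ ν_n }` (with `sup ∅ = 0`). -/
noncomputable def treeDist {X Y : OmTree.{u}} (μ ν : OmTreeHom X Y) : ℝ :=
  sSup {x : ℝ | ∃ n : ℕ, μ.app n ≠ ν.app n ∧ x = (2 : ℝ) ^ (-(n : ℤ))}

theorem zpow_le_treeDist {X Y : OmTree.{u}} {μ ν : OmTreeHom X Y} {n : ℕ}
    (h : μ.app n ≠ ν.app n) : (2 : ℝ) ^ (-(n : ℤ)) ≤ treeDist μ ν := by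
  refine le_csSup ⟨1, ?_⟩ ⟨n, h, rfl⟩
  rintro _ ⟨m, -, rfl⟩
  exact zpow_le_one_of_nonpos₀ one_le_two (by omega)

theorem treeDist_nonneg {X Y : OmTree.{u}} (μ ν : OmTreeHom X Y) : 0 ≤ treeDist μ ν := by
  apply Real.sSup_nonneg
  rintro _ ⟨n, -, rfl⟩
  positivity

/-- If agreement of `μ` and `ν` strictly below stage `n` forces agreement of `μ'` and `ν'` at
stage `n`, then the distance is at least halved. -/
theorem treeDist_le_half {X Y X' Y' : OmTree.{u}} {μ ν : OmTreeHom X Y} {μ' ν' : OmTreeHom X' Y'}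
    (h : ∀ n, (∀ m < n, μ.app m = ν.app m) → μ'.app n = ν'.app n) :
    treeDist μ' ν' ≤ (1 / 2) * treeDist μ ν := by
  refine Real.sSup_le ?_ (mul_nonneg (by norm_num) (treeDist_nonneg μ ν))
  rintro _ ⟨n, hn, rfl⟩
  obtain ⟨m, hmn, hm⟩ : ∃ m < n, μ.app m ≠ ν.app m := by
    by_contra! hc
    exact hn (h n hc)
  calc (2 : ℝ) ^ (-(n : ℤ)) ≤ 2 ^ (-1 + -(m : ℤ)) := zpow_le_zpow_right₀ one_le_two (by omega)
    _ = (1 / 2) * 2 ^ (-(m : ℤ)) := by rw [zpow_add₀ two_ne_zero]; norm_num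
    _ ≤ (1 / 2) * treeDist μ ν := by gcongr; exact zpow_le_treeDist hm

theorem laterMap_app_congr {X Y : OmTree.{u}} {f g : OmTreeHom X Y} {n : ℕ}
    (h : ∀ m < n, f.app m = g.app m) : (laterMap f).app n = (laterMap g).app n := by
  cases n with
  | zero => rfl
  | succ m => exact h m m.lt_succ_self

theorem expPre_congr {X X' Y : OmTree.{u}} {f g : OmTreeHom X X'} {n : ℕ}
    (h : ∀ i ≤ n, f.app i = g.app i) : expPre (Y := Y) f n = expPre g n := by
  funext e
  simp only [expPre, ExpEl.mk.injEq]
  funext i hi x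
  rw [h i hi]

theorem expPost_congr {X Y Y' : OmTree.{u}} {f g : OmTreeHom Y Y'} {n : ℕ}
    (h : ∀ i ≤ n, f.app i = g.app i) : expPost (X := X) f n = expPost g n := by
  funext e
  simp only [expPost, ExpEl.mk.injEq]
  funext i hi x
  rw [h i hi]

/-- The bifunctor `B^u(X,Y) = ▷Y + (▷Y)^{▷X}` on the topos of trees
is locally contractive with factor `1/2` in each argument. -/
theorem Bu_locally_contractive :
    (∀ (X X' Y : OmTree.{u}) (f g : OmTreeHom X X'),
      treeDist (BuMapL Y f) (BuMapL Y g) ≤ (1 / 2) * treeDist f g) ∧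
    (∀ (X Y Y' : OmTree.{u}) (f g : OmTreeHom Y Y'),
      treeDist (BuMapR X f) (BuMapR X g) ≤ (1 / 2) * treeDist f g) := by
  refine ⟨fun X X' Y f g => treeDist_le_half fun n h => ?_,
    fun X Y Y' f g => treeDist_le_half fun n h => ?_⟩
  all_goals
    have later_eq : ∀ i ≤ n, (laterMap f).app i = (laterMap g).app i := fun i hi =>
      laterMap_app_congr fun m hm => h m (hm.trans_le hi)
  · exact congrArg (Sum.map fun y => y) (expPre_congr later_eq)
  · exact congrArg₂ Sum.map (later_eq n le_rfl) (expPost_congr later_eq)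
end

section
/- The xPTCL behaviour bifunctor B^p on Set^Ty has a locally final coalgebra, and any two locally final coalgebras for B^p are isomorphic as higher-order B^p-coalgebras. -/
universe u

/-- A finite probability distribution on `X`: a finitely supported function
`φ : X → [0,1] ⊆ ℝ` with nonnegative values summing up to `1`. -/
def FinDist (X : Type u) : Type u :=
  { φ : X →₀ ℝ // (∀ x : X, 0 ≤ φ x) ∧ φ.sum (fun _ r => r) = 1 }

/-- Pushforward of finite distributions along a map (the action of `D_ω` on maps). -/
noncomputable def pushforward {X Y : Type u} (f : X → Y) (φ : FinDist X) : FinDist Y := by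
  refine ⟨Finsupp.mapDomain f φ.1, ?_, ?_⟩
  · intro y
    classical
    rw [Finsupp.mapDomain, Finsupp.sum_apply]
    refine Finset.sum_nonneg ?_
    intro x _
    simp only [Finsupp.single_apply]
    split
    · exact φ.2.1 x
    · exact le_refl 0
  · rw [Finsupp.sum_mapDomain_index (fun _ => rfl) (fun _ _ _ => rfl)]
    exact φ.2.2

/-- The xPTCL behaviour bifunctor on objects:
`B^p_unit(X,Y) = D_ω(Y_unit) + 1`, `B^p_{τ₁→τ₂}(X,Y) = D_ω(Y_{τ₁→τ₂}) + Y_{τ₂}^{X_{τ₁}}`. -/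
def BpObj (X Y : TySet.{u}) : TySet.{u} := fun τ =>
  match τ with
  | .unit => FinDist (Y .unit) ⊕ PUnit
  | .arrow τ₁ τ₂ => FinDist (Y (.arrow τ₁ τ₂)) ⊕ (X τ₁ → Y τ₂)

/-- The action of the bifunctor `B^p` on morphisms: contravariant in the first
argument, covariant in the second one. -/
noncomputable def BpMap {X X' Y Y' : TySet.{u}} (f : TyHom X' X) (g : TyHom Y Y') :
    TyHom (BpObj X Y) (BpObj X' Y')
  | .unit, .inl φ => .inl (pushforward (g .unit) φ)
  | .unit, .inr u => .inr u
  | .arrow τ₁ τ₂, .inl φ => .inl (pushforward (g (.arrow τ₁ τ₂)) φ)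
  | .arrow τ₁ τ₂, .inr ψ => .inr (fun x => g τ₂ (ψ (f τ₁ x)))

/-- `h` is a morphism of higher-order `B^p`-coalgebras `(X,c) → (Y,d)`. -/
def IsHOCoalgHomP {X Y : TySet.{u}} (c : TyHom X (BpObj X X)) (d : TyHom Y (BpObj Y Y))
    (h : TyHom X Y) : Prop :=
  ∀ (τ : Ty) (x : X τ), BpMap (tyId X) h τ (c τ x) = BpMap h (tyId Y) τ (d τ (h τ x))

/-- A locally final coalgebra for `B^p`. -/
def IsLocallyFinalP (Z : TySet.{u}) (z : TyHom Z (BpObj Z Z)) : Prop :=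
  ∀ (A : TySet.{u}) (c : TyHom A (BpObj Z A)),
    ∃! h : TyHom A Z, ∀ (τ : Ty) (a : A τ), z τ (h τ a) = BpMap (tyId Z) h τ (c τ a)

theorem pushforward_id {X : Type u} (φ : FinDist X) : pushforward (fun x => x) φ = φ :=
  Subtype.ext Finsupp.mapDomain_id

theorem pushforward_pushforward {X Y Z : Type u} (f : X → Y) (g : Y → Z) (φ : FinDist X) :
    pushforward g (pushforward f φ) = pushforward (fun x => g (f x)) φ :=
  Subtype.ext Finsupp.mapDomain_comp.symm

/-- Every finite distribution is the pushforward of a finite distribution on the naturals. -/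
theorem exists_pushforward_nat {X : Type u} (φ : FinDist X) :
    ∃ (p : FinDist (ULift.{u} ℕ)) (f : ULift.{u} ℕ → X), pushforward f p = φ := by
  have hne : φ.1.support.Nonempty := by
    rw [Finset.nonempty_iff_ne_empty]
    intro h
    have h1 := φ.2.2
    simp [Finsupp.sum, h] at h1
  have : Nonempty X := ⟨hne.choose⟩
  obtain ⟨e, he⟩ := Set.countable_iff_exists_injOn.1 φ.1.support.countable_toSet
  refine ⟨pushforward (fun x => ULift.up (e x)) φ,
    fun n => Function.invFunOn e φ.1.support n.down, ?_⟩
  rw [pushforward_pushforward]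
  refine Subtype.ext ?_
  refine (Finsupp.mapDomain_congr fun x hx => ?_).trans Finsupp.mapDomain_id
  exact he.leftInvOn_invFunOn hx

/-- The functor `D_ω(-) + A`. -/
def DistSum (A Y : Type u) : Type u := FinDist Y ⊕ A

noncomputable instance (A : Type u) : Functor (DistSum A) where
  map f := Sum.map (pushforward f) id

/-- The polynomial functor of which `D_ω(-) + A` is a quotient. -/
def distSumP (A : Type u) : PFunctor.{u, u} where
  A := FinDist (ULift.{u} ℕ) ⊕ A
  B := Sum.elim (fun _ => ULift.{u} ℕ) (fun _ => PEmpty)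

/-- The quotient map from the polynomial functor `distSumP A` to `D_ω(-) + A`. -/
noncomputable def distSumAbs {A Y : Type u} : distSumP A Y → DistSum A Y
  | ⟨.inl p, f⟩ => .inl (pushforward f p)
  | ⟨.inr a, _⟩ => .inr a

theorem distSumAbs_surjective {A Y : Type u} :
    Function.Surjective (distSumAbs : distSumP A Y → DistSum A Y) := by
  rintro (φ | a)
  · obtain ⟨p, f, h⟩ := exists_pushforward_nat φ
    exact ⟨⟨.inl p, f⟩, congrArg Sum.inl h⟩
  · exact ⟨⟨.inr a, PEmpty.elim⟩, rfl⟩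

noncomputable instance (A : Type u) : QPF (DistSum A) where
  P := distSumP A
  abs := distSumAbs
  repr := Function.surjInv distSumAbs_surjective
  abs_repr := Function.surjInv_eq distSumAbs_surjective
  abs_map := by
    rintro α β f ⟨p | a, g⟩
    · exact congrArg Sum.inl (pushforward_pushforward g f p).symm
    · rfl

/-- `z` is a final coalgebra for the functor `D_ω(-) + A`. -/
def IsFinalDistSum {Z A : Type u} (z : Z → FinDist Z ⊕ A) : Prop :=
  ∀ (Y : Type u) (c : Y → FinDist Y ⊕ A),
    ∃! h : Y → Z, ∀ y, z (h y) = Sum.map (pushforward h) id (c y)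

theorem isFinalDistSum_cofix (A : Type u) :
    IsFinalDistSum (QPF.Cofix.dest : QPF.Cofix (DistSum A) → DistSum A _) := by
  intro Y c
  refine ⟨QPF.Cofix.corec (F := DistSum A) c, QPF.Cofix.dest_corec (F := DistSum A) c, ?_⟩
  intro h hh
  funext y
  refine QPF.Cofix.bisim' (F := DistSum A) (fun _ => True) h _ (fun x _ => ?_) y trivial
  obtain ⟨⟨a, g⟩, hg⟩ := distSumAbs_surjective (A := A) (c x)
  refine ⟨a, fun i => h (g i), fun i => QPF.Cofix.corec (F := DistSum A) c (g i), ?_, ?_,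
    fun i => ⟨g i, trivial, rfl, rfl⟩⟩
  · refine (hh x).trans ?_
    rw [← hg]
    exact (QPF.abs_map (F := DistSum A) h ⟨a, g⟩).symm
  · refine (QPF.Cofix.dest_corec (F := DistSum A) c x).trans ?_
    rw [← hg]
    exact (QPF.abs_map (F := DistSum A) _ ⟨a, g⟩).symm

/-- Final coalgebras for `D_ω(-) + A` and `D_ω(-) + B` are isomorphic over a bijection `A ≃ B`. -/
theorem IsFinalDistSum.exists_equiv {Z W A B : Type u} {z : Z → FinDist Z ⊕ A}
    {w : W → FinDist W ⊕ B} (hz : IsFinalDistSum z) (hw : IsFinalDistSum w) (e : A ≃ B) :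
    ∃ f : Z ≃ W, ∀ x, w (f x) = Sum.map (pushforward f) e (z x) := by
  obtain ⟨f, hf, -⟩ := hw Z fun x => Sum.map id e (z x)
  obtain ⟨g, hg, -⟩ := hz W fun x => Sum.map id e.symm (w x)
  refine ⟨⟨f, g, fun x => ?_, fun x => ?_⟩, fun x => ?_⟩
  · refine congrFun ((hz Z z).unique (y₁ := fun x => g (f x)) (y₂ := fun x => x) ?_ ?_) x
    · intro x
      rw [hg, hf]
      cases z x <;> simp [pushforward_pushforward]
    · intro x
      cases z x <;> simp [pushforward_id]
  · refine congrFun ((hw W w).unique (y₁ := fun x => f (g x)) (y₂ := fun x => x) ?_ ?_) x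
    · intro x
      rw [hf, hg]
      cases w x <;> simp [pushforward_pushforward]
    · intro x
      cases w x <;> simp [pushforward_id]
  · refine (hf x).trans ?_
    cases z x <;> rfl

theorem map_symm_of_map {Z W A B : Type u} {z : Z → FinDist Z ⊕ A} {w : W → FinDist W ⊕ B}
    {e : A ≃ B} {f : Z ≃ W} (h : ∀ x, w (f x) = Sum.map (pushforward f) e (z x)) (y : W) :
    z (f.symm y) = Sum.map (pushforward f.symm) e.symm (w y) := by
  obtain ⟨x, rfl⟩ := f.surjective y
  rw [h, f.symm_apply_apply]
  cases z x <;> simp [pushforward_pushforward, pushforward_id]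

/-- The coalgebra `z` is final in each sort separately. -/
structure IsSortwiseFinal (Z : TySet.{u}) (z : TyHom Z (BpObj Z Z)) : Prop where
  unit : IsFinalDistSum (A := PUnit) (z .unit)
  arrow (τ₁ τ₂ : Ty) : IsFinalDistSum (A := Z τ₁ → Z τ₂) (z (.arrow τ₁ τ₂))

/-- The coalgebra homomorphism from `c` into a sortwise final coalgebra. -/
noncomputable def IsSortwiseFinal.unfold {Z : TySet.{u}} {z : TyHom Z (BpObj Z Z)}
    (hz : IsSortwiseFinal Z z) {A : TySet.{u}} (c : TyHom A (BpObj Z A)) : TyHom A Z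
  | .unit => (hz.unit (A .unit) (c .unit)).choose
  | .arrow τ₁ τ₂ => (hz.arrow τ₁ τ₂ (A (.arrow τ₁ τ₂)) fun a =>
      Sum.map id (fun ψ x => hz.unfold c τ₂ (ψ x)) (c (.arrow τ₁ τ₂) a)).choose

theorem BpMap_unit {Z A A' : TySet.{u}} (h : TyHom A A') (b : BpObj Z A .unit) :
    BpMap (tyId Z) h .unit b = Sum.map (pushforward (h .unit)) id b := by
  cases b <;> rfl

theorem BpMap_arrow {Z A A' : TySet.{u}} (h : TyHom A A') (τ₁ τ₂ : Ty)
    (b : BpObj Z A (.arrow τ₁ τ₂)) :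
    BpMap (tyId Z) h (.arrow τ₁ τ₂) b =
      Sum.map (pushforward (h (.arrow τ₁ τ₂))) id
        (Sum.map id (fun ψ x => h τ₂ (ψ x)) b) := by
  cases b <;> rfl

theorem IsSortwiseFinal.isLocallyFinalP {Z : TySet.{u}} {z : TyHom Z (BpObj Z Z)}
    (hz : IsSortwiseFinal Z z) : IsLocallyFinalP Z z := by
  intro A c
  refine ⟨hz.unfold c, ?_, ?_⟩
  · rintro (_ | ⟨τ₁, τ₂⟩) a
    · rw [BpMap_unit]
      exact (hz.unit (A .unit) (c .unit)).choose_spec.1 a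
    · rw [BpMap_arrow]
      exact (hz.arrow τ₁ τ₂ (A (.arrow τ₁ τ₂)) fun a =>
        Sum.map id (fun ψ x => hz.unfold c τ₂ (ψ x)) (c (.arrow τ₁ τ₂) a)).choose_spec.1 a
  · intro g hg
    funext τ
    induction τ with
    | unit =>
      refine (hz.unit (A .unit) (c .unit)).choose_spec.2 _ fun a => ?_
      rw [hg, BpMap_unit]
    | arrow τ₁ τ₂ _ ih =>
      refine (hz.arrow τ₁ τ₂ (A (.arrow τ₁ τ₂)) fun a =>
        Sum.map id (fun ψ x => hz.unfold c τ₂ (ψ x)) (c (.arrow τ₁ τ₂) a)).choose_spec.2 _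
        fun a => ?_
      rw [hg, BpMap_arrow, ih]

/-- The sortwise final `Ty`-sorted set. -/
noncomputable def finalTySet : TySet.{u}
  | .unit => QPF.Cofix (DistSum PUnit)
  | .arrow τ₁ τ₂ => QPF.Cofix (DistSum (finalTySet τ₁ → finalTySet τ₂))

/-- The coalgebra structure on `finalTySet`. -/
noncomputable def finalCoalg : TyHom finalTySet.{u} (BpObj finalTySet finalTySet)
  | .unit => QPF.Cofix.dest (F := DistSum PUnit)
  | .arrow τ₁ τ₂ => QPF.Cofix.dest (F := DistSum (finalTySet τ₁ → finalTySet τ₂))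

theorem isSortwiseFinal_finalCoalg : IsSortwiseFinal finalTySet.{u} finalCoalg where
  unit := isFinalDistSum_cofix PUnit
  arrow τ₁ τ₂ := isFinalDistSum_cofix (finalTySet τ₁ → finalTySet τ₂)

/-- The `Ty`-sorted set `Z` with a set `Y` of additional elements in sort `τ`. -/
inductive Extend (Z : TySet.{u}) (τ : Ty) (Y : Type u) : Ty → Type u
  | base {σ : Ty} : Z σ → Extend Z τ Y σ
  | extra : Y → Extend Z τ Y τ

/-- A coalgebra on `Extend Z τ Y` extending `z`. -/
noncomputable def Extend.coalg {Z : TySet.{u}} (z : TyHom Z (BpObj Z Z)) {τ : Ty} {Y : Type u}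
    (c : Y → BpObj Z (Extend Z τ Y) τ) : TyHom (Extend Z τ Y) (BpObj Z (Extend Z τ Y))
  | σ, .base x => BpMap (tyId Z) (fun _ => .base) σ (z σ x)
  | _, .extra y => c y

/-- The copairing of the identity of `Z` with a map into `Z τ`. -/
def Extend.lift {Z : TySet.{u}} {τ : Ty} {Y : Type u} (g : Y → Z τ) : TyHom (Extend Z τ Y) Z
  | _, .base x => x
  | _, .extra y => g y

theorem BpMap_id_id {X Y : TySet.{u}} (τ : Ty) (b : BpObj X Y τ) :
    BpMap (tyId X) (tyId Y) τ b = b := by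
  cases τ <;> rcases b with φ | ψ
  · exact congrArg Sum.inl (pushforward_id φ)
  · rfl
  · exact congrArg Sum.inl (pushforward_id φ)
  · rfl

theorem BpMap_BpMap {X A B C : TySet.{u}} (f : TyHom A B) (g : TyHom B C) (τ : Ty)
    (b : BpObj X A τ) :
    BpMap (tyId X) g τ (BpMap (tyId X) f τ b) = BpMap (tyId X) (tyComp f g) τ b := by
  cases τ <;> rcases b with φ | ψ
  · exact congrArg Sum.inl (pushforward_pushforward _ _ φ)
  · rfl
  · exact congrArg Sum.inl (pushforward_pushforward _ _ φ)
  · rfl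

/-- Coalgebras `c` in a single sort, with successors in `Y` or in `Z`, have a unique solution in a
locally final coalgebra. -/
theorem IsLocallyFinalP.existsUnique_extend {Z : TySet.{u}} {z : TyHom Z (BpObj Z Z)}
    (hz : IsLocallyFinalP Z z) {τ : Ty} {Y : Type u} (c : Y → BpObj Z (Extend Z τ Y) τ) :
    ∃! g : Y → Z τ, ∀ y, z τ (g y) = BpMap (tyId Z) (Extend.lift g) τ (c y) := by
  obtain ⟨h, hh, huniq⟩ := hz _ (Extend.coalg z c)
  have hbase : (fun σ x => h σ (.base x)) = tyId Z :=
    (hz Z z).unique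
      (fun σ x => (hh σ (.base x)).trans (BpMap_BpMap _ _ σ (z σ x)))
      (fun σ x => (BpMap_id_id σ (z σ x)).symm)
  have hlift : Extend.lift (fun y => h τ (.extra y)) = h := by
    funext σ x
    cases x with
    | base x => exact (congrFun (congrFun hbase σ) x).symm
    | extra y => rfl
  refine ⟨fun y => h τ (.extra y), fun y => ?_, fun g hg => ?_⟩
  · rw [hlift]
    exact hh τ (.extra y)
  · have := huniq (Extend.lift g) fun σ x => by
      cases x with
      | base x =>
        exact (BpMap_id_id σ (z σ x)).symm.trans
          (BpMap_BpMap (fun _ => Extend.base (τ := τ) (Y := Y)) (Extend.lift g) σ (z σ x)).symm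
      | extra y => exact hg y
    rw [← this]
    rfl

theorem IsLocallyFinalP.isSortwiseFinal {Z : TySet.{u}} {z : TyHom Z (BpObj Z Z)}
    (hz : IsLocallyFinalP Z z) : IsSortwiseFinal Z z where
  unit Y c := by
    refine (existsUnique_congr fun g => forall_congr' fun y => ?_).1
      (hz.existsUnique_extend (τ := .unit) fun y => Sum.map (pushforward .extra) id (c y))
    refine iff_of_eq (congrArg (z .unit (g y) = ·) ?_)
    rcases c y with φ | a
    · exact congrArg Sum.inl (pushforward_pushforward _ _ φ)
    · rfl
  arrow τ₁ τ₂ Y c := by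
    refine (existsUnique_congr fun g => forall_congr' fun y => ?_).1
      (hz.existsUnique_extend (τ := .arrow τ₁ τ₂) fun y =>
        Sum.map (pushforward .extra) (fun ψ x => .base (ψ x)) (c y))
    refine iff_of_eq (congrArg (z (.arrow τ₁ τ₂) (g y) = ·) ?_)
    rcases c y with φ | a
    · exact congrArg Sum.inl (pushforward_pushforward _ _ φ)
    · rfl

/-- The comparison bijections between two sortwise final coalgebras. -/
noncomputable def IsSortwiseFinal.equiv {Z W : TySet.{u}} {z : TyHom Z (BpObj Z Z)}
    {w : TyHom W (BpObj W W)} (hz : IsSortwiseFinal Z z) (hw : IsSortwiseFinal W w) :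
    ∀ τ : Ty, Z τ ≃ W τ
  | .unit => (hz.unit.exists_equiv hw.unit (Equiv.refl _)).choose
  | .arrow τ₁ τ₂ => ((hz.arrow τ₁ τ₂).exists_equiv (hw.arrow τ₁ τ₂)
      ((hz.equiv hw τ₁).arrowCongr (hz.equiv hw τ₂))).choose

/-- A sortwise bijection which is compatible with the coalgebra structures up to conjugation is a
morphism of higher-order coalgebras. -/
theorem isHOCoalgHomP_of_equiv {Z W : TySet.{u}} {z : TyHom Z (BpObj Z Z)}
    {w : TyHom W (BpObj W W)} (e : ∀ τ, Z τ ≃ W τ)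
    (hunit : ∀ x, w .unit (e .unit x) = Sum.map (pushforward (e .unit)) id (z .unit x))
    (harrow : ∀ τ₁ τ₂ x, w (.arrow τ₁ τ₂) (e (.arrow τ₁ τ₂) x) =
      Sum.map (pushforward (e (.arrow τ₁ τ₂))) ((e τ₁).arrowCongr (e τ₂)) (z (.arrow τ₁ τ₂) x)) :
    IsHOCoalgHomP z w fun τ => e τ := by
  rintro (_ | ⟨τ₁, τ₂⟩) x
  · rw [hunit]
    rcases z .unit x with φ | a
    · exact congrArg Sum.inl (pushforward_id _).symm
    · rfl
  · rw [harrow]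
    rcases z (.arrow τ₁ τ₂) x with φ | ψ
    · exact congrArg Sum.inl (pushforward_id _).symm
    · refine congrArg Sum.inr (funext fun y => ?_)
      simp [tyId]


/-- The xPTCL behaviour bifunctor `B^p` on `Set^Ty` has a locally
final coalgebra, and any two locally final coalgebras for `B^p` are isomorphic as
higher-order `B^p`-coalgebras. -/
theorem xPTCL_locally_final_exists_unique :
    (∃ (Z : TySet.{u}) (z : TyHom Z (BpObj Z Z)), IsLocallyFinalP Z z) ∧
    (∀ (Z : TySet.{u}) (z : TyHom Z (BpObj Z Z)) (W : TySet.{u}) (w : TyHom W (BpObj W W)),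
      IsLocallyFinalP Z z → IsLocallyFinalP W w →
      ∃ (h : TyHom Z W) (k : TyHom W Z),
        tyComp h k = tyId Z ∧ tyComp k h = tyId W ∧
        IsHOCoalgHomP z w h ∧ IsHOCoalgHomP w z k) := by
  refine ⟨⟨finalTySet, finalCoalg, isSortwiseFinal_finalCoalg.isLocallyFinalP⟩, ?_⟩
  intro Z z W w hZ hW
  have hz := hZ.isSortwiseFinal
  have hw := hW.isSortwiseFinal
  have hunit := (hz.unit.exists_equiv hw.unit (Equiv.refl _)).choose_spec
  have harrow := fun τ₁ τ₂ => ((hz.arrow τ₁ τ₂).exists_equiv (hw.arrow τ₁ τ₂)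
    ((hz.equiv hw τ₁).arrowCongr (hz.equiv hw τ₂))).choose_spec
  refine ⟨fun τ => hz.equiv hw τ, fun τ => (hz.equiv hw τ).symm, ?_, ?_,
    isHOCoalgHomP_of_equiv _ hunit harrow,
    isHOCoalgHomP_of_equiv _ (map_symm_of_map hunit)
      fun τ₁ τ₂ => map_symm_of_map (harrow τ₁ τ₂)⟩
  · funext τ x
    exact (hz.equiv hw τ).symm_apply_apply x
  · funext τ x
    exact (hz.equiv hw τ).apply_symm_apply x
end
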